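/- arXiv:2504.14213 — 2 statements merged into one kernel-verified Lean document; each statement's English description precedes it below -/
import Mathlib

section
/- Let (X,d) be a metric space with |X| ≥ n ≥ 3, and let T : X → X be an n-point Kannan-type mapping. Then T has no periodic point of prime period n; i.e., there is no x ∈ X with Tⁿx = x and Tᵏx ≠ x for all 1 ≤ k < n. -/
open Finset Filter Topology

/-- The sum of all pairwise distances between the points `x 0, …, x (n-1)`. -/
noncomputable def pairSum {X : Type*} [MetricSpace X] {n : ℕ} (x : Fin n → X) : ℝ :=
  ∑ i : Fin n, ∑ j ∈ Finset.Ioi i, dist (x i) (x j)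

/-- Twice the sum over unordered pairs is the sum over all ordered pairs. -/
theorem two_mul_pairSum {X : Type*} [MetricSpace X] {n : ℕ} (x : Fin n → X) :
    2 * pairSum x = ∑ i : Fin n, ∑ j : Fin n, dist (x i) (x j) := by
  have hswap : ∑ i : Fin n, ∑ j ∈ Finset.Iio i, dist (x i) (x j) = pairSum x := by
    unfold pairSum
    rw [Finset.sum_comm' (t' := Finset.univ) (s' := fun j => Finset.Ioi j) (by simp)]
    simp only [dist_comm]
  have hsplit (i : Fin n) : ∑ j : Fin n, dist (x i) (x j) =
      ∑ j ∈ Finset.Iio i, dist (x i) (x j) + ∑ j ∈ Finset.Ioi i, dist (x i) (x j) := by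
    rw [← Finset.sum_union
      (Finset.disjoint_left.2 fun j hj hj' =>
        lt_asymm (Finset.mem_Iio.1 hj) (Finset.mem_Ioi.1 hj'))]
    refine (Finset.sum_subset (Finset.subset_univ _) fun j _ hj => ?_).symm
    have hji : j = i := by
      simp only [Finset.mem_union, Finset.mem_Iio, Finset.mem_Ioi, not_or, not_lt] at hj
      exact le_antisymm hj.2 hj.1
    rw [hji, dist_self]
  simp only [hsplit, Finset.sum_add_distrib, hswap]
  rw [two_mul]
  rfl

/-- With at least three points, the length of the closed polygon through the points is at most
the sum of all pairwise distances. -/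
theorem sum_dist_succ_le_pairSum {X : Type*} [MetricSpace X] {m : ℕ} (x : Fin (m + 3) → X) :
    ∑ i, dist (x i) (x (i + 1)) ≤ pairSum x := by
  have hne : (1 : Fin (m + 3)) ≠ -1 := by
    intro h
    have h2 : (1 : Fin (m + 3)) + 1 = 0 := by
      nth_rewrite 2 [h]
      exact add_neg_cancel 1
    have hval := congrArg Fin.val h2
    simp [Fin.val_add, Nat.mod_eq_of_lt] at hval
  have hrow (i : Fin (m + 3)) :
      dist (x i) (x (i + 1)) + dist (x i) (x (i + -1)) ≤ ∑ j, dist (x i) (x j) := by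
    rw [← Equiv.sum_comp (Equiv.addLeft i) (fun j => dist (x i) (x j)),
      ← Finset.sum_pair (f := fun j => dist (x i) (x (i + j))) hne]
    exact Finset.sum_le_sum_of_subset_of_nonneg (Finset.subset_univ _)
      fun _ _ _ => dist_nonneg
  have hpred : ∑ i, dist (x i) (x (i + -1)) = ∑ i, dist (x i) (x (i + 1)) := by
    rw [← Equiv.sum_comp (Equiv.addRight (1 : Fin (m + 3)))]
    simp [dist_comm]
  have hsum := Finset.sum_le_sum fun i (_ : i ∈ Finset.univ) => hrow i
  rw [Finset.sum_add_distrib, hpred, ← two_mul_pairSum] at hsum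
  linarith

/-- An `n`-point Kannan-type mapping (`n ≥ 3`) has no periodic point of prime
period `n`. -/
theorem statement10 {X : Type*} [MetricSpace X] (n : ℕ) (hn : 3 ≤ n)
    (hcard : ∃ f : Fin n → X, Function.Injective f)
    (T : X → X)
    (lam : ℝ) (hlam0 : 0 ≤ lam) (hlam1 : lam < ((n : ℝ) - 1) / n)
    (hK : ∀ x : Fin n → X, Function.Injective x →
      pairSum (fun i => T (x i)) ≤ lam * ∑ i : Fin n, dist (x i) (T (x i))) :
    ¬∃ x : X, T^[n] x = x ∧ ∀ k : ℕ, 1 ≤ k → k < n → T^[k] x ≠ x := by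
  rintro ⟨a, ha, hmin⟩
  obtain ⟨m, rfl⟩ : ∃ m, n = m + 3 := ⟨n - 3, by omega⟩
  let x : Fin (m + 3) → X := fun i => T^[i] a
  have hper : Function.minimalPeriod T a = m + 3 := by
    have hpt : Function.IsPeriodicPt T (m + 3) a := ha
    refine le_antisymm (hpt.minimalPeriod_le (by omega)) ?_
    by_contra! hlt
    exact hmin _ (hpt.minimalPeriod_pos (by omega)) hlt
      (Function.isPeriodicPt_minimalPeriod T a)
  have hx : Function.Injective x := fun i j hij =>
    Fin.ext (Function.iterate_injOn_Iio_minimalPeriod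
      (Set.mem_Iio.2 (i.isLt.trans_eq hper.symm))
      (Set.mem_Iio.2 (j.isLt.trans_eq hper.symm)) hij)
  have hT (i : Fin (m + 3)) : T (x i) = x (i + 1) := by
    change T (T^[i] a) = T^[((i + 1 : Fin (m + 3)) : ℕ)] a
    have hmod := Function.iterate_mod_minimalPeriod_eq (f := T) (x := a) (n := i + 1)
    rw [hper] at hmod
    rw [← Function.iterate_succ_apply' T, Fin.val_add, Fin.val_one, hmod]
  have hle := sum_dist_succ_le_pairSum fun i => T (x i)
  have hcontr := hK x hx
  simp only [hT] at hle hcontr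
  have hshift := Equiv.sum_comp (Equiv.addRight (1 : Fin (m + 3)))
    (fun i => dist (x i) (x (i + 1)))
  simp only [Equiv.coe_addRight] at hshift
  rw [hshift] at hle
  have hpos : 0 < ∑ i, dist (x i) (x (i + 1)) :=
    Finset.sum_pos (fun i _ => dist_pos.2 fun h => by simpa using hx h) Finset.univ_nonempty
  have hlam : lam < 1 := hlam1.trans_le
    (div_le_one_of_le₀ (sub_le_self _ zero_le_one) (Nat.cast_nonneg _))
  nlinarith
end

section
/- Let (X,d) be a complete metric space with |X| ≥ n ≥ 2, and let T : X → X be continuous and asymptotically regular. Suppose there exist functions β₁,…,βₙ : [0,∞) → [0,∞), each with limsup_{t→0⁺} βᵢ(t) < ∞, such that S(Tx₁,…,Txₙ) ≤ Σᵢ₌₁ⁿ βᵢ(d(xᵢ,Txᵢ))·d(xᵢ,Txᵢ) for all pairwise distinct points x₁,…,xₙ ∈ X. Then T has a fixed point in X, and T has at most n−1 fixed points. -/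
open Finset Filter Topology

theorem dist_le_pairSum {X : Type*} [MetricSpace X] {n : ℕ} (x : Fin n → X) {i j : Fin n}
    (hij : i < j) : dist (x i) (x j) ≤ pairSum x :=
  calc dist (x i) (x j) ≤ ∑ k ∈ Finset.Ioi i, dist (x i) (x k) :=
        Finset.single_le_sum (f := fun k => dist (x i) (x k)) (fun _ _ => dist_nonneg)
          (Finset.mem_Ioi.2 hij)
    _ ≤ pairSum x :=
        Finset.single_le_sum (f := fun l => ∑ k ∈ Finset.Ioi l, dist (x l) (x k))
          (fun _ _ => Finset.sum_nonneg fun _ _ => dist_nonneg) (Finset.mem_univ i)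

/-- If consecutive iterates get arbitrarily close and `T` has no fixed point, then no orbit
of `T` revisits a point. -/
theorem injective_iterate_of_tendsto_dist {X : Type*} [MetricSpace X] {T : X → X} {x : X}
    (hx : Tendsto (fun m => dist (T^[m] x) (T^[m + 1] x)) atTop (𝓝 0))
    (hfix : ∀ w, T w ≠ w) : Function.Injective fun m => T^[m] x := by
  refine Function.Injective.of_lt_imp_ne fun a b hab heq => hfix (T^[a] x) ?_
  have hper : T^[b - a] (T^[a] x) = T^[a] x := by
    rw [← Function.iterate_add_apply, Nat.sub_add_cancel hab.le]
    exact heq.symm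
  have hret : ∀ k, T^[(b - a) * k + a] x = T^[a] x := fun k => by
    rw [Function.iterate_add_apply, Function.iterate_mul]
    exact Function.iterate_fixed hper k
  have hsub : Tendsto (fun k => (b - a) * k + a) atTop atTop :=
    tendsto_atTop_mono (fun k => (Nat.le_mul_of_pos_left k (Nat.sub_pos_of_lt hab)).trans
      (Nat.le_add_right _ _)) tendsto_id
  have hlim := hx.comp hsub
  simp only [Function.comp_def, Function.iterate_succ_apply', hret] at hlim
  exact (dist_eq_zero.1 (tendsto_nhds_unique tendsto_const_nhds hlim)).symm

theorem tendsto_mul_self_of_isBoundedUnder {b : ℝ → ℝ} {d : ℕ → ℝ}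
    (hb0 : ∀ t, 0 ≤ t → 0 ≤ b t) (hb : IsBoundedUnder (· ≤ ·) (𝓝[>] 0) b)
    (hd : Tendsto d atTop (𝓝 0)) (hpos : ∀ m, 0 < d m) :
    Tendsto (fun m => b (d m) * d m) atTop (𝓝 0) := by
  obtain ⟨M, hM⟩ := hb
  have hd' : Tendsto d atTop (𝓝[>] 0) :=
    tendsto_nhdsWithin_iff.2 ⟨hd, Eventually.of_forall hpos⟩
  have hbd : ∀ᶠ m in atTop, b (d m) ≤ M := hd'.eventually (eventually_map.1 hM)
  refine squeeze_zero' (g := fun m => M * d m)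
    (Eventually.of_forall fun m => mul_nonneg (hb0 _ (hpos m).le) (hpos m).le) ?_ ?_
  · filter_upwards [hbd] with m hm
    exact mul_le_mul_of_nonneg_right hm (hpos m).le
  · simpa using hd.const_mul M

/-- A continuous, asymptotically regular `n`-point `𝓑`-Kannan-type mapping on a
complete metric space (with `βᵢ : [0,∞) → [0,∞)` having finite limsup at `0⁺`) has a
fixed point, and has at most `n−1` fixed points. -/
theorem statement15 {X : Type*} [MetricSpace X] [CompleteSpace X] (n : ℕ) (hn : 2 ≤ n)
    (hcard : ∃ f : Fin n → X, Function.Injective f)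
    (T : X → X) (hTc : Continuous T)
    (har : ∀ x : X,
      Filter.Tendsto (fun m => dist (T^[m] x) (T^[m + 1] x)) Filter.atTop (nhds 0))
    (β : Fin n → ℝ → ℝ)
    (hβ0 : ∀ i : Fin n, ∀ t : ℝ, 0 ≤ t → 0 ≤ β i t)
    (hβb : ∀ i : Fin n, Filter.IsBoundedUnder (· ≤ ·) (nhdsWithin 0 (Set.Ioi 0)) (β i))
    (hK : ∀ x : Fin n → X, Function.Injective x →
      pairSum (fun i => T (x i)) ≤
        ∑ i : Fin n, β i (dist (x i) (T (x i))) * dist (x i) (T (x i))) :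
    (∃ w : X, T w = w) ∧
    ¬∃ w : Fin n → X, Function.Injective w ∧ ∀ i, T (w i) = w i := by
  have h01 : (⟨0, by omega⟩ : Fin n) < ⟨1, by omega⟩ := Fin.mk_lt_mk.2 one_pos
  refine ⟨?_, ?_⟩
  · by_contra! hfix
    obtain ⟨f, -⟩ := hcard
    set x₀ : X := f ⟨0, by omega⟩
    have hinj := injective_iterate_of_tendsto_dist (har x₀) hfix
    set u : ℕ → X := fun m => T^[m] x₀
    have hsucc : ∀ m, T (u m) = u (m + 1) := fun m => (Function.iterate_succ_apply' T m x₀).symm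
    have hterm : ∀ i, Tendsto (fun m => β i (dist (u m) (u (m + 1))) * dist (u m) (u (m + 1)))
        atTop (𝓝 0) := fun i =>
      tendsto_mul_self_of_isBoundedUnder (hβ0 i) (hβb i) (har x₀)
        fun m => dist_pos.2 (hinj.ne (Nat.lt_succ_self m).ne)
    have hn0 : (0 : ℝ) < n := by exact_mod_cast (by omega : 0 < n)
    have hclose : ∀ ε > 0, ∃ N, ∀ p q, N ≤ p → p < q → dist (u (p + 1)) (u (q + 1)) < ε := by
      intro ε hε
      obtain ⟨N, hN⟩ := eventually_atTop.1 (eventually_all.2 fun i =>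
        (hterm i).eventually_lt_const (show (0 : ℝ) < ε / 2 / n by positivity))
      refine ⟨N, fun p q hp hpq => ?_⟩
      let g : Fin n → ℕ := fun i => if (i : ℕ) = 0 then p else q + (i - 1)
      have hg : Function.Injective g := by
        intro i j hij
        simp only [g] at hij
        ext
        split_ifs at hij <;> omega
      have hgN : ∀ i, N ≤ g i := by
        intro i
        simp only [g]
        split_ifs <;> omega
      calc dist (u (p + 1)) (u (q + 1))
          = dist (T (u (g ⟨0, by omega⟩))) (T (u (g ⟨1, by omega⟩))) := by simp [hsucc, g]
        _ ≤ pairSum fun i => T (u (g i)) := dist_le_pairSum (fun i => T (u (g i))) h01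
        _ ≤ ∑ i, β i (dist (u (g i)) (T (u (g i)))) * dist (u (g i)) (T (u (g i))) :=
            hK (fun i => u (g i)) (hinj.comp hg)
        _ ≤ ∑ _i : Fin n, ε / 2 / n := Finset.sum_le_sum fun i _ => by
            rw [hsucc]
            exact (hN (g i) (hgN i) i).le
        _ = ε / 2 := by
            rw [Finset.sum_const, Finset.card_univ, Fintype.card_fin, nsmul_eq_mul]
            field_simp
        _ < ε := half_lt_self hε
    have hcau : CauchySeq fun m => u (m + 1) := by
      refine Metric.cauchySeq_iff.2 fun ε hε => ?_
      obtain ⟨N, hN⟩ := hclose ε hε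
      refine ⟨N, fun p hp q hq => ?_⟩
      rcases lt_trichotomy p q with h | rfl | h
      · exact hN p q hp h
      · simpa using hε
      · rw [dist_comm]
        exact hN q p hq h
    obtain ⟨w, hw⟩ := cauchySeq_tendsto_of_complete hcau
    exact hfix w (isFixedPt_of_tendsto_iterate ((tendsto_add_atTop_iff_nat 1).1 hw)
      hTc.continuousAt)
  · rintro ⟨w, hw, hfix⟩
    have hle := (dist_le_pairSum (fun i => T (w i)) h01).trans (hK w hw)
    simp only [hfix, dist_self, mul_zero, Finset.sum_const_zero] at hle
    exact h01.ne (hw (dist_le_zero.1 hle))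
end
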